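/- arXiv:1909.07632 — 3 statements merged into one kernel-verified Lean document; each statement's English description precedes it below -/
import Mathlib

section
/- Let N be a natural number with N ≥ 2, and let A be a point on the unit sphere of the Euclidean space ℝ^N (i.e., ‖A‖₂ = 1). Let B be a random point distributed according to the uniform probability measure on the unit sphere of ℝ^N. Then for every real d with 0 < d ≤ 1, the probability that ‖A − B‖₂ ≤ d is at most (1/2)·d^(N−1). -/
open MeasureTheory ProbabilityTheory Metric

open scoped RealInnerProductSpace NNReal ENNReal

/-- The scalar inequality behind the Lipschitz bound for `capMap`. -/
lemma mul_two_sub_le_of_le_geom {t s m p P G : ℝ} (ht0 : 0 ≤ t) (ht1 : t ≤ 1) (hs0 : 0 ≤ s)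
    (hs1 : s ≤ 1) (hm0 : 0 ≤ m) (hm1 : m ≤ 2 / 3) (hp : p ≤ P) (hP0 : 0 ≤ P)
    (hP : P ^ 2 = t * (2 - t) * (s * (2 - s))) (hG0 : 0 ≤ G)
    (hG : G ^ 2 * ((2 - t) * (2 - s)) = (2 - m * t) * (2 - m * s)) :
    p * (2 - G) ≤ t + s - (2 - m) * (t * s) := by
  have hts : 0 ≤ t * s := mul_nonneg ht0 hs0
  have hmt : 0 ≤ m * t := mul_nonneg hm0 ht0
  have hms : 0 ≤ m * s := mul_nonneg hm0 hs0
  have hmt1 : m * t ≤ 2 / 3 := by nlinarith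
  have hms1 : m * s ≤ 2 / 3 := by nlinarith
  have hTS : 1 ≤ (2 - t) * (2 - s) := by nlinarith
  have hG2 : G ≤ 2 := by
    have h1 : (2 - m * t) * (2 - m * s) ≤ 4 := by nlinarith
    have h2 : G ^ 2 ≤ 4 := by nlinarith [sq_nonneg G]
    nlinarith
  obtain ⟨q, hq0, hq⟩ : ∃ q : ℝ, 0 ≤ q ∧ q ^ 2 = t * s := ⟨√(t * s), by positivity, Real.sq_sqrt hts⟩
  have hq1 : q ≤ 1 := by nlinarith
  have hδ : 0 ≤ t + s - 2 * q := by
    have : (2 * q) ^ 2 ≤ (t + s) ^ 2 := by nlinarith [sq_nonneg (t - s)]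
    linarith [abs_le_of_sq_le_sq' this (by linarith)]
  obtain ⟨R, hR0, hR⟩ : ∃ R : ℝ, 0 ≤ R ∧ R ^ 2 = (2 - t) * (2 - s) :=
    ⟨√((2 - t) * (2 - s)), by positivity, Real.sq_sqrt (by linarith)⟩
  have hPqR : P = q * R := by
    rw [← sq_eq_sq₀ hP0 (mul_nonneg hq0 hR0), hP, mul_pow, hq, hR]; ring
  have hR2 : R ≤ 2 - q := by
    refine abs_le_of_sq_le_sq (by nlinarith) (by linarith) |>.trans' (le_abs_self R)
  have hQ0 : 0 ≤ R * G := mul_nonneg hR0 hG0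
  have hQ : (R * G) ^ 2 = (2 - m * t) * (2 - m * s) := by rw [mul_pow, hR, ← hG]; ring
  have hmq : m * q ≤ 2 / 3 := by nlinarith
  have hD : ((2 - m * q) - R * G) * ((2 - m * q) + R * G) = 2 * m * (t + s - 2 * q) := by
    linear_combination (-1 : ℝ) * hQ + m ^ 2 * hq
  have hD1 : (2 - m * q) - R * G ≤ t + s - 2 * q := by
    by_contra! h
    have h1 := mul_le_mul_of_nonneg_left (show 4 / 3 ≤ (2 - m * q) + R * G by linarith)
      (hδ.trans h.le)
    have h2 := mul_le_mul_of_nonneg_right hm1 hδ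
    linarith
  have h1 : p * (2 - G) ≤ P * (2 - G) := mul_le_mul_of_nonneg_right hp (by linarith)
  have h2 : q * ((2 - m * q) - R * G) ≤ t + s - 2 * q :=
    (mul_le_mul_of_nonneg_left hD1 hq0).trans (mul_le_of_le_one_left hδ hq1)
  have h3 : q * R ≤ q * (2 - q) := mul_le_mul_of_nonneg_left hR2 hq0
  rw [hPqR] at h1
  linear_combination h1 + 2 * h3 + h2 - (2 - m) * hq

section CapMap

variable {E : Type*} [NormedAddCommGroup E] [InnerProductSpace ℝ E]

/-- The map of the open hemisphere around `A` which preserves the meridians through `A` and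
multiplies the chordal distance to `A` by `√m`. -/
noncomputable def capMap (A : E) (m : ℝ) (x : E) : E :=
  (1 - m * (1 - ⟪A, x⟫)) • A +
    (√m * √((2 - m * (1 - ⟪A, x⟫)) / (2 - (1 - ⟪A, x⟫)))) • (x - ⟪A, x⟫ • A)

/-- The open hemisphere with pole `A`. -/
def openHemisphere (A : E) : Set E := {x | x ∈ sphere (0 : E) 1 ∧ 0 < ⟪A, x⟫}

lemma norm_sq_smul_add_of_inner_eq_zero {A u : E} (hA : ‖A‖ = 1) (r : ℝ) (hu : ⟪A, u⟫ = 0) :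
    ‖r • A + u‖ ^ 2 = r ^ 2 + ‖u‖ ^ 2 := by
  rw [norm_add_sq_real, inner_smul_left, hu, norm_smul, hA]
  simp

lemma inner_sub_inner_smul {A : E} (hA : ‖A‖ = 1) (x : E) : ⟪A, x - ⟪A, x⟫ • A⟫ = 0 := by
  rw [inner_sub_right, inner_smul_right, real_inner_self_eq_norm_sq, hA]; ring

lemma norm_sq_sub_inner_smul {A x : E} (hA : ‖A‖ = 1) (hx : ‖x‖ = 1) :
    ‖x - ⟪A, x⟫ • A‖ ^ 2 = 1 - ⟪A, x⟫ ^ 2 := by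
  have h := norm_sq_smul_add_of_inner_eq_zero hA ⟪A, x⟫ (inner_sub_inner_smul hA x)
  rw [add_sub_cancel, hx] at h
  linarith

lemma norm_sq_smul_sub_smul (a b : ℝ) (v w : E) :
    ‖a • v - b • w‖ ^ 2 = a ^ 2 * ‖v‖ ^ 2 - 2 * (a * b * ⟪v, w⟫) + b ^ 2 * ‖w‖ ^ 2 := by
  rw [norm_sub_sq_real, inner_smul_left, inner_smul_right, norm_smul, norm_smul, mul_pow, mul_pow]
  simp [mul_assoc]

lemma norm_capMap_sub_le {A : E} (hA : ‖A‖ = 1) {m : ℝ} (hm0 : 0 ≤ m) (hm1 : m ≤ 2 / 3)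
    {x y : E} (hx : x ∈ openHemisphere A) (hy : y ∈ openHemisphere A) :
    ‖capMap A m x - capMap A m y‖ ≤ √(2 * m) * ‖x - y‖ := by
  obtain ⟨hx1, hx0⟩ := hx
  obtain ⟨hy1, hy0⟩ := hy
  rw [mem_sphere_zero_iff_norm] at hx1 hy1
  have hv := norm_sq_sub_inner_smul hA hx1
  have hw := norm_sq_sub_inner_smul hA hy1
  have hAv := inner_sub_inner_smul hA x
  have hAw := inner_sub_inner_smul hA y
  have hax : ⟪A, x⟫ ≤ 1 := by simpa [hA, hx1] using real_inner_le_norm A x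
  have hay : ⟪A, y⟫ ≤ 1 := by simpa [hA, hy1] using real_inner_le_norm A y
  have hxy : x - y = (⟪A, x⟫ - ⟪A, y⟫) • A +
      ((1 : ℝ) • (x - ⟪A, x⟫ • A) - (1 : ℝ) • (y - ⟪A, y⟫ • A)) := by module
  unfold capMap
  generalize x - ⟪A, x⟫ • A = v at *
  generalize y - ⟪A, y⟫ • A = w at *
  obtain ⟨t, ht⟩ : ∃ t, ⟪A, x⟫ = 1 - t := ⟨1 - ⟪A, x⟫, by ring⟩
  obtain ⟨s, hs⟩ : ∃ s, ⟪A, y⟫ = 1 - s := ⟨1 - ⟪A, y⟫, by ring⟩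
  simp only [ht, hs, sub_sub_cancel] at hx0 hy0 hv hw hxy hax hay ⊢
  have hgt0 : 0 ≤ (2 - m * t) / (2 - t) := div_nonneg (by nlinarith) (by linarith)
  have hgs0 : 0 ≤ (2 - m * s) / (2 - s) := div_nonneg (by nlinarith) (by linarith)
  have hgt := Real.sq_sqrt hgt0
  have hgs := Real.sq_sqrt hgs0
  have hgtn := Real.sqrt_nonneg ((2 - m * t) / (2 - t))
  have hgsn := Real.sqrt_nonneg ((2 - m * s) / (2 - s))
  rw [eq_div_iff (by linarith)] at hgt hgs
  generalize √((2 - m * t) / (2 - t)) = g at *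
  generalize √((2 - m * s) / (2 - s)) = k at *
  have key := mul_two_sub_le_of_le_geom (t := t) (s := s) (m := m) (p := ⟪v, w⟫)
    (P := ‖v‖ * ‖w‖) (G := g * k) (by linarith) (by linarith) (by linarith) (by linarith) hm0 hm1
    (real_inner_le_norm v w) (by positivity)
    (by rw [mul_pow, hv, hw]; ring) (by positivity)
    (by rw [← hgt, ← hgs]; ring)
  have hc := Real.sq_sqrt hm0
  have hL : ‖((1 - m * t) • A + (√m * g) • v) - ((1 - m * s) • A + (√m * k) • w)‖ ^ 2 =
      (m * (s - t)) ^ 2 + (m * (t * (2 - m * t)) - 2 * (m * (g * k) * ⟪v, w⟫)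
        + m * (s * (2 - m * s))) := by
    rw [show ((1 - m * t) • A + (√m * g) • v) - ((1 - m * s) • A + (√m * k) • w) =
      (m * (s - t)) • A + ((√m * g) • v - (√m * k) • w) by module,
      norm_sq_smul_add_of_inner_eq_zero hA _
        (by rw [inner_sub_right, inner_smul_right, inner_smul_right, hAv, hAw]; ring),
      norm_sq_smul_sub_smul, hv, hw]
    linear_combination (g ^ 2 * (1 - (1 - t) ^ 2) + k ^ 2 * (1 - (1 - s) ^ 2)
      - 2 * g * k * ⟪v, w⟫) * hc + m * t * hgt + m * s * hgs
  have hR : ‖x - y‖ ^ 2 = (s - t) ^ 2 + (t * (2 - t) - 2 * ⟪v, w⟫ + s * (2 - s)) := by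
    rw [hxy, norm_sq_smul_add_of_inner_eq_zero hA _
        (by rw [inner_sub_right, inner_smul_right, inner_smul_right, hAv, hAw]; ring),
      norm_sq_smul_sub_smul, hv, hw]
    ring
  refine (sq_le_sq₀ (norm_nonneg _) (by positivity)).1 ?_
  rw [hL, mul_pow √(2 * m), Real.sq_sqrt (by positivity), hR]
  nlinarith [mul_le_mul_of_nonneg_left key hm0]

lemma cap_subset_image_capMap {A : E} (hA : ‖A‖ = 1) {m d : ℝ} (hm1 : m ≤ 2 / 3)
    (hd : 0 ≤ d) (hdm : d ^ 2 < 2 * m) :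
    sphere (0 : E) 1 ∩ {y | ‖A - y‖ ≤ d} ⊆ capMap A m '' openHemisphere A := by
  rintro y ⟨hy1, hyd : ‖A - y‖ ≤ d⟩
  rw [mem_sphere_zero_iff_norm] at hy1
  have hm0 : 0 < m := by nlinarith [sq_nonneg d]
  have hw := norm_sq_sub_inner_smul hA hy1
  have hAw := inner_sub_inner_smul hA y
  have hay : ⟪A, y⟫ ≤ 1 := by simpa [hA, hy1] using real_inner_le_norm A y
  have hlt : 1 - ⟪A, y⟫ < m := by
    have h := norm_sub_sq_real A y
    rw [hA, hy1] at h
    nlinarith [norm_nonneg (A - y)]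
  have hyw : y = ⟪A, y⟫ • A + (y - ⟪A, y⟫ • A) := by module
  generalize y - ⟪A, y⟫ • A = w at *
  obtain ⟨t, ht⟩ : ∃ t, ⟪A, y⟫ = 1 - m * t :=
    ⟨(1 - ⟪A, y⟫) / m, by field_simp; ring⟩
  rw [ht] at hw hay hlt hyw
  have ht0 : 0 ≤ t := by
    by_contra! h
    nlinarith
  have ht1 : t < 1 := by nlinarith
  have hg0 : 0 < (2 - m * t) / (2 - t) := div_pos (by nlinarith) (by linarith)
  have hβ0 : 0 < √m * √((2 - m * t) / (2 - t)) := by positivity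
  have hβ : (√m * √((2 - m * t) / (2 - t))) ^ 2 * (2 - t) = m * (2 - m * t) := by
    have : 2 - t ≠ 0 := by linarith
    rw [mul_pow, Real.sq_sqrt hm0.le, Real.sq_sqrt hg0.le]
    field_simp
  have hAx : ⟪A, (1 - t) • A + (√m * √((2 - m * t) / (2 - t)))⁻¹ • w⟫ = 1 - t := by
    rw [inner_add_right, inner_smul_right, inner_smul_right, hAw, real_inner_self_eq_norm_sq, hA]
    ring
  refine ⟨(1 - t) • A + (√m * √((2 - m * t) / (2 - t)))⁻¹ • w, ⟨?_, by rw [hAx]; linarith⟩, ?_⟩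
  · rw [mem_sphere_zero_iff_norm, ← sq_eq_sq₀ (norm_nonneg _) zero_le_one,
      norm_sq_smul_add_of_inner_eq_zero hA _ (by rw [inner_smul_right, hAw, mul_zero]),
      norm_smul, mul_pow, hw, Real.norm_eq_abs, sq_abs, inv_pow]
    generalize √m * √((2 - m * t) / (2 - t)) = β at *
    field_simp
    linear_combination -t * hβ
  · unfold capMap
    rw [hAx, sub_sub_cancel, add_sub_cancel_left, smul_inv_smul₀ hβ0.ne', ← hyw]

variable [MeasurableSpace E] [BorelSpace E]

lemma hausdorffMeasure_cap_le {A : E} (hA : ‖A‖ = 1) {d e : ℝ} (hd : 0 ≤ d) (hde : d < e)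
    (he : e ^ 2 ≤ 4 / 3) {r : ℝ} (hr : 0 ≤ r) :
    μH[r] (sphere (0 : E) 1 ∩ {y | ‖A - y‖ ≤ d}) ≤
      ENNReal.ofReal e ^ r * μH[r] (openHemisphere A) := by
  have hlip : LipschitzOnWith e.toNNReal (capMap A (e ^ 2 / 2)) (openHemisphere A) := by
    refine LipschitzOnWith.of_dist_le_mul fun x hx y hy ↦ ?_
    have h := norm_capMap_sub_le hA (m := e ^ 2 / 2) (by positivity) (by linarith) hx hy
    rw [mul_div_cancel₀ _ (two_ne_zero), Real.sqrt_sq (by linarith), ← dist_eq_norm,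
      ← dist_eq_norm] at h
    rwa [Real.coe_toNNReal e (by linarith)]
  exact (measure_mono (cap_subset_image_capMap hA (by linarith) hd (by nlinarith))).trans
    (hlip.hausdorffMeasure_image_le hr)

lemma two_mul_hausdorffMeasure_openHemisphere_le (A : E) {r : ℝ} (hr : 0 ≤ r) :
    2 * μH[r] (openHemisphere A) ≤ μH[r] (sphere (0 : E) 1) := by
  have hneg : μH[r] ((fun x : E ↦ -x) '' openHemisphere A) = μH[r] (openHemisphere A) :=
    (IsometryEquiv.neg E).isometry.hausdorffMeasure_image (Or.inl hr) _
  have hmeas : MeasurableSet (openHemisphere A) :=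
    isClosed_sphere.measurableSet.inter
      (isOpen_lt continuous_const (by fun_prop : Continuous fun x : E ↦ ⟪A, x⟫)).measurableSet
  have hdisj : Disjoint ((fun x : E ↦ -x) '' openHemisphere A) (openHemisphere A) := by
    rw [Set.disjoint_left]
    rintro _ ⟨x, hx, rfl⟩ h
    have h1 := hx.2
    have h2 := h.2
    rw [inner_neg_right] at h2
    linarith
  rw [two_mul]
  nth_rw 1 [← hneg]
  rw [← measure_union hdisj hmeas]
  refine measure_mono (Set.union_subset ?_ fun x hx ↦ hx.1)
  rintro _ ⟨x, hx, rfl⟩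
  simpa using hx.1

end CapMap

/-- Lemma 1 of the paper: if `A` is a fixed point on the unit sphere of `ℝ^N` and `B` is
drawn from the uniform probability measure on the unit sphere (the `(N-1)`-dimensional
Hausdorff measure restricted to the sphere and normalized), then the probability that
`‖A - B‖₂ ≤ d` is at most `(1/2) · d^(N-1)` for every `0 < d ≤ 1`. -/
theorem brute_force_sphere_cap_bound (N : ℕ) (hN : 2 ≤ N)
    (A : EuclideanSpace ℝ (Fin N)) (hA : ‖A‖ = 1)
    (d : ℝ) (hd0 : 0 < d) (hd1 : d ≤ 1) :
    ProbabilityTheory.cond (μH[(N : ℝ) - 1])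
        (sphere (0 : EuclideanSpace ℝ (Fin N)) 1)
        {B : EuclideanSpace ℝ (Fin N) | ‖A - B‖ ≤ d} ≤
      ENNReal.ofReal ((1 / 2) * d ^ (N - 1)) := by
  have hcast : (N : ℝ) - 1 = ((N - 1 : ℕ) : ℝ) := by
    rw [Nat.cast_sub (by omega), Nat.cast_one]
  have hr : (0 : ℝ) ≤ (N : ℝ) - 1 := by rw [hcast]; positivity
  have hcont : Filter.Tendsto (fun e : ℝ ↦ ENNReal.ofReal ((1 / 2) * e ^ (N - 1)))
      (nhdsWithin d (Set.Ioi d)) (nhds (ENNReal.ofReal ((1 / 2) * d ^ (N - 1)))) :=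
    (ENNReal.continuous_ofReal.comp (by fun_prop)).continuousWithinAt
  refine ge_of_tendsto hcont ?_
  filter_upwards [Ioo_mem_nhdsGT (show d < d + 1 / 10 by linarith)] with e he
  have hcap := hausdorffMeasure_cap_le hA hd0.le he.1 (by nlinarith [he.1, he.2]) hr
  have hhemi := two_mul_hausdorffMeasure_openHemisphere_le A hr
  rw [cond_apply isClosed_sphere.measurableSet]
  rw [show ENNReal.ofReal e ^ ((N : ℝ) - 1) = ENNReal.ofReal (e ^ (N - 1)) by
    rw [hcast, ENNReal.rpow_natCast, ENNReal.ofReal_pow (by linarith [he.1])]] at hcap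
  generalize μH[(N : ℝ) - 1] (sphere (0 : EuclideanSpace ℝ (Fin N)) 1) = S at *
  generalize μH[(N : ℝ) - 1] (openHemisphere A) = H at *
  have hhalf : ENNReal.ofReal (1 / 2) * 2 = 1 := by
    rw [← ENNReal.ofReal_ofNat 2, ← ENNReal.ofReal_mul (by norm_num)]; norm_num
  calc S⁻¹ * _ ≤ S⁻¹ * (ENNReal.ofReal (e ^ (N - 1)) * H) := by gcongr
    _ = ENNReal.ofReal (1 / 2) * ENNReal.ofReal (e ^ (N - 1)) * (S⁻¹ * (2 * H)) := by
      rw [show ENNReal.ofReal (1 / 2) * ENNReal.ofReal (e ^ (N - 1)) * (S⁻¹ * (2 * H)) =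
        (ENNReal.ofReal (1 / 2) * 2) * (S⁻¹ * (ENNReal.ofReal (e ^ (N - 1)) * H)) by ring,
        hhalf, one_mul]
    _ ≤ ENNReal.ofReal (1 / 2) * ENNReal.ofReal (e ^ (N - 1)) * (S⁻¹ * S) := by gcongr
    _ ≤ ENNReal.ofReal (1 / 2) * ENNReal.ofReal (e ^ (N - 1)) * 1 := by
      gcongr
      exact ENNReal.inv_mul_le_one S
    _ = ENNReal.ofReal ((1 / 2) * e ^ (N - 1)) := by
      rw [mul_one, ENNReal.ofReal_mul (by norm_num)]
end

section
/- Let (Ω, μ) be a probability space, q a positive natural number, and T : Ω → ℝ^q a random row vector such that for all indices i, j, the product Tᵢ·Tⱼ is integrable with ∫ Tᵢ(ω)·Tⱼ(ω) dμ equal to 1/q when i = j and 0 otherwise. Let W and G be real q×q matrices normalized so that their squared Frobenius norms both equal q (i.e., Σᵢⱼ Wᵢⱼ² = Σᵢⱼ Gᵢⱼ² = q). Define the original data D(ω) = T(ω) ᵥ· W and the recovered data 𝒟(ω) = T(ω) ᵥ· G, and let N = q² (the number of elements of W). Then for every σ > 0, the expected mean squared error satisfies ∫ (1/q)·‖D(ω)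 − 𝒟(ω)‖₂² dμ ≤ σ²/√N if and only if the Frobenius distance between the rescaled matrices satisfies ‖(1/√q)·W − (1/√q)·G‖_F ≤ σ. -/
open MeasureTheory Matrix

/-- If the coordinates of a random vector `T` are uncorrelated with common second moment `c`, then
the expected squared Euclidean norm of `T ᵥ* A` is `c` times the squared Frobenius norm of `A`. -/
theorem integral_sum_sq_vecMul {Ω m n : Type*} [MeasurableSpace Ω] {μ : Measure Ω}
    [Fintype m] [DecidableEq m] [Fintype n] {T : Ω → m → ℝ} {c : ℝ}
    (hint : ∀ i j, Integrable (fun ω => T ω i * T ω j) μ)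
    (hmom : ∀ i j, ∫ ω, T ω i * T ω j ∂μ = if i = j then c else 0) (A : Matrix m n ℝ) :
    ∫ ω, ∑ k, (Matrix.vecMul (T ω) A k) ^ 2 ∂μ = c * ∑ i, ∑ k, (A i k) ^ 2 := by
  have expand (ω : Ω) : ∑ k, (Matrix.vecMul (T ω) A k) ^ 2 =
      ∑ k, ∑ i, ∑ j, T ω i * T ω j * (A i k * A j k) := by
    refine Finset.sum_congr rfl fun k _ => ?_
    simp only [Matrix.vecMul, dotProduct, sq, Finset.sum_mul_sum]
    exact Finset.sum_congr rfl fun i _ => Finset.sum_congr rfl fun j _ => by ring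
  have term_int (i j : m) (k : n) :
      Integrable (fun ω => T ω i * T ω j * (A i k * A j k)) μ := (hint i j).mul_const _
  have row_int (i : m) (k : n) :
      Integrable (fun ω => ∑ j, T ω i * T ω j * (A i k * A j k)) μ :=
    integrable_finsetSum _ fun j _ => term_int i j k
  simp_rw [expand]
  rw [integral_finsetSum _ fun k _ => integrable_finsetSum _ fun i _ => row_int i k,
    Finset.sum_comm (s := Finset.univ (α := m)), Finset.mul_sum]
  refine Finset.sum_congr rfl fun k _ => ?_
  rw [integral_finsetSum _ fun i _ => row_int i k, Finset.mul_sum]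
  refine Finset.sum_congr rfl fun i _ => ?_
  rw [integral_finsetSum _ fun j _ => term_int i j k]
  simp [integral_mul_const, hmom, sq]

/-- Lemma 2 of the paper: with original data `D = T ᵥ· W` and recovered data
`𝒟 = T ᵥ· G`, where `W` and `G` have squared Frobenius norm `q` and the coordinates of
`T` satisfy `E[Tᵢ Tⱼ] = δᵢⱼ / q`, the expected mean squared error between `D` and `𝒟`
is at most `σ² / √N` (with `N = q²` the number of elements of `W`) exactly when the
normalized matrices `W/√q` and `G/√q` are within Frobenius distance `σ`. -/
theorem expected_rms_error_iff_frobenius_close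
    {Ω : Type*} [MeasurableSpace Ω] (μ : Measure Ω) [IsProbabilityMeasure μ]
    (q : ℕ) (hq : 0 < q) (T : Ω → Fin q → ℝ)
    (hint : ∀ i j : Fin q, Integrable (fun ω => T ω i * T ω j) μ)
    (hmom : ∀ i j : Fin q,
      ∫ ω, T ω i * T ω j ∂μ = if i = j then 1 / (q : ℝ) else 0)
    (W G : Matrix (Fin q) (Fin q) ℝ)
    (hW : ∑ i, ∑ j, (W i j) ^ 2 = (q : ℝ))
    (hG : ∑ i, ∑ j, (G i j) ^ 2 = (q : ℝ))
    (D 𝒟 : Ω → Fin q → ℝ)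
    (hD : ∀ ω, D ω = Matrix.vecMul (T ω) W)
    (h𝒟 : ∀ ω, 𝒟 ω = Matrix.vecMul (T ω) G)
    (N : ℕ) (hN : N = q ^ 2)
    (σ : ℝ) (hσ : 0 < σ) :
    (∫ ω, (1 / (q : ℝ)) * ∑ k, (D ω k - 𝒟 ω k) ^ 2 ∂μ ≤ σ ^ 2 / Real.sqrt N) ↔
      Real.sqrt (∑ i, ∑ j,
          ((1 / Real.sqrt q) * W i j - (1 / Real.sqrt q) * G i j) ^ 2) ≤ σ := by
  have hq' : (0 : ℝ) < q := by exact_mod_cast hq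
  have diff (ω : Ω) (k : Fin q) : D ω k - 𝒟 ω k = Matrix.vecMul (T ω) (W - G) k := by
    rw [hD, h𝒟, Matrix.vecMul_sub, Pi.sub_apply]
  have frob : ∑ i, ∑ j, ((1 / Real.sqrt q) * W i j - (1 / Real.sqrt q) * G i j) ^ 2 =
      1 / (q : ℝ) * ∑ i, ∑ j, ((W - G) i j) ^ 2 := by
    simp_rw [← mul_sub, mul_pow, ← Finset.mul_sum, one_div, inv_pow, Real.sq_sqrt hq'.le,
      Matrix.sub_apply]
  have hsqrt : Real.sqrt N = q := by
    rw [hN, Nat.cast_pow, Real.sqrt_sq hq'.le]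
  simp_rw [diff]
  rw [integral_const_mul, integral_sum_sq_vecMul hint hmom, hsqrt, frob, Real.sqrt_le_left hσ.le,
    one_div_mul_eq_div (q : ℝ) (1 / (q : ℝ) * _), div_le_div_iff_of_pos_right hq']
end

section
/- Let α, β, m, p be positive natural numbers with p ≤ m, and set n = m − p + 1. Let D : Fin α → Fin m → Fin m → ℝ be input data and K : Fin α → Fin β → Fin p → Fin p → ℝ be convolutional kernels, and define the valid convolution output F : Fin β → Fin n → Fin n → ℝ by F j c d = Σ_{i < α} Σ_{a < p} Σ_{b < p} K i j a b · D i (c + a) (d + b). Define the unrolled data row vector Dʳ ∈ ℝ^(α·m²) by Dʳ(i·m² + x·m + y) = D i x y, the unrolled feature row vector Fʳ ∈ ℝ^(β·n²) by Fʳ(j·n² + c·n + d) = F j c d, and the matrix C of size (α·m²) × (β·n²) whose entry at row i·m² + (a + c)·m + (b + d) and column j·n² + c·n + d equals K i j a b for all i < α, j < β, a, b < p, c, d < n, and whose all other entries are 0. Then the vector–matrix product satisfies Dʳ ᵥ· C = Fʳ. -/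
open Matrix

/-- Index bound for the d2r unrolling: if `i < α` and `x, y < m` then
`i·m² + x·m + y < α·m²`. -/
theorem d2r_index_lt {α m i x y : ℕ} (hi : i < α) (hx : x < m) (hy : y < m) :
    i * m ^ 2 + x * m + y < α * m ^ 2 := by
  have h1 : i + 1 ≤ α := hi
  have h2 : (i + 1) * m ^ 2 ≤ α * m ^ 2 := Nat.mul_le_mul_right _ h1
  have h3 : x * m + y < m ^ 2 := by nlinarith
  nlinarith

/-- The unrolling `(i, x, y) ↦ i·m² + x·m + y` is injective on coordinates `x, y < m`. -/
theorem d2r_index_inj {m i x y i' x' y' : ℕ} (hx : x < m) (hy : y < m) (hx' : x' < m)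
    (hy' : y' < m) (h : i * m ^ 2 + x * m + y = i' * m ^ 2 + x' * m + y') :
    i = i' ∧ x = x' ∧ y = y' := by
  have hm : 0 < m := by omega
  have digits : ∀ {q r q' r' : ℕ}, r < m → r' < m → q * m + r = q' * m + r' →
      q = q' ∧ r = r' := by
    intro q r q' r' hr hr' e
    have hq := congrArg (· / m) e
    have hmod := congrArg (· % m) e
    simp only [Nat.mul_add_mod_self_right, Nat.mod_eq_of_lt hr, Nat.mod_eq_of_lt hr'] at hmod
    subst hmod
    exact ⟨Nat.eq_of_mul_eq_mul_right hm (by omega), rfl⟩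
  have h' : (i * m + x) * m + y = (i' * m + x') * m + y' := by linarith
  obtain ⟨hq, hyy⟩ := digits hy hy' h'
  obtain ⟨hi, hxx⟩ := digits hx hx' hq
  exact ⟨hi, hxx, hyy⟩

/-- Every index below `α·m²` is the unrolling of some coordinates. -/
theorem exists_d2r_index {α m : ℕ} (z : Fin (α * m ^ 2)) :
    ∃ (i : Fin α) (x y : Fin m),
      z = ⟨i.val * m ^ 2 + x.val * m + y.val, d2r_index_lt i.isLt x.isLt y.isLt⟩ := by
  have hz := z.isLt
  have hm : 0 < m := by
    rcases Nat.eq_zero_or_pos m with rfl | h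
    · simp at hz
    · exact h
  have hi : z.val / m / m < α := by
    rw [Nat.div_div_eq_div_mul, ← sq]
    exact Nat.div_lt_of_lt_mul (hz.trans_eq (mul_comm _ _))
  refine ⟨⟨z.val / m / m, hi⟩, ⟨z.val / m % m, Nat.mod_lt _ hm⟩, ⟨z.val % m, Nat.mod_lt _ hm⟩,
    Fin.ext ?_⟩
  have h₁ := Nat.div_add_mod z.val m
  have h₂ := Nat.div_add_mod (z.val / m) m
  calc z.val = m * (m * (z.val / m / m) + z.val / m % m) + z.val % m := by rw [h₂, h₁]
    _ = _ := by ring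

/-- Correctness of the paper's data-to-row-vector (d2r) construction: the valid
convolution `F` of the data `D` with kernels `K` is exactly computed by multiplying the
unrolled data row vector `Dʳ` by the matrix `C` built from the kernel weights according
to equation (1); that is, `Dʳ ᵥ· C = Fʳ`. -/
theorem d2r_vecMul_eq_conv
    (α β m p : ℕ) (hα : 0 < α) (hβ : 0 < β) (hm : 0 < m) (hp : 0 < p) (hpm : p ≤ m)
    (n : ℕ) (hn : n = m - p + 1)
    (D : Fin α → Fin m → Fin m → ℝ)
    (K : Fin α → Fin β → Fin p → Fin p → ℝ)
    (F : Fin β → Fin n → Fin n → ℝ)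
    (hF : ∀ (j : Fin β) (c d : Fin n),
      F j c d = ∑ i : Fin α, ∑ a : Fin p, ∑ b : Fin p,
        K i j a b * D i ⟨c.val + a.val, by have := c.isLt; have := a.isLt; omega⟩
          ⟨d.val + b.val, by have := d.isLt; have := b.isLt; omega⟩)
    (Dr : Fin (α * m ^ 2) → ℝ)
    (hDr : ∀ (i : Fin α) (x y : Fin m),
      Dr ⟨i.val * m ^ 2 + x.val * m + y.val, d2r_index_lt i.isLt x.isLt y.isLt⟩ = D i x y)
    (Fr : Fin (β * n ^ 2) → ℝ)
    (hFr : ∀ (j : Fin β) (c d : Fin n),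
      Fr ⟨j.val * n ^ 2 + c.val * n + d.val, d2r_index_lt j.isLt c.isLt d.isLt⟩ = F j c d)
    (C : Matrix (Fin (α * m ^ 2)) (Fin (β * n ^ 2)) ℝ)
    (hC : ∀ (i : Fin α) (j : Fin β) (a b : Fin p) (c d : Fin n),
      C ⟨i.val * m ^ 2 + (a.val + c.val) * m + (b.val + d.val),
          d2r_index_lt i.isLt (by have := a.isLt; have := c.isLt; omega)
            (by have := b.isLt; have := d.isLt; omega)⟩
        ⟨j.val * n ^ 2 + c.val * n + d.val, d2r_index_lt j.isLt c.isLt d.isLt⟩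
        = K i j a b)
    (hC0 : ∀ (x : Fin (α * m ^ 2)) (y : Fin (β * n ^ 2)),
      (¬ ∃ (i : Fin α) (j : Fin β) (a b : Fin p) (c d : Fin n),
        x.val = i.val * m ^ 2 + (a.val + c.val) * m + (b.val + d.val) ∧
        y.val = j.val * n ^ 2 + c.val * n + d.val) → C x y = 0) :
    Matrix.vecMul Dr C = Fr := by
  ext z
  obtain ⟨j, c, d, rfl⟩ := exists_d2r_index z
  rw [hFr, hF]
  rw [← Fintype.sum_prod_type', ← Fintype.sum_prod_type']
  simp only [Matrix.vecMul, dotProduct]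
  have row_lt (a : Fin p) (c : Fin n) : a.val + c.val < m := by
    have := a.isLt
    have := c.isLt
    omega
  symm
  refine Fintype.sum_of_injective
    (fun t : (Fin α × Fin p) × Fin p =>
      (⟨t.1.1.val * m ^ 2 + (t.1.2.val + c.val) * m + (t.2.val + d.val),
        d2r_index_lt t.1.1.isLt (row_lt _ _) (row_lt _ _)⟩ : Fin (α * m ^ 2))) ?_ _ _ ?_ ?_
  · rintro ⟨⟨i, a⟩, b⟩ ⟨⟨i', a'⟩, b'⟩ h
    obtain ⟨hi, ha, hb⟩ := d2r_index_inj (row_lt _ _) (row_lt _ _) (row_lt _ _) (row_lt _ _)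
      (Fin.ext_iff.mp h)
    simp only at hi ha hb
    simp only [Prod.mk.injEq, Fin.ext_iff]
    omega
  · intro x hx
    refine mul_eq_zero_of_right _ (hC0 _ _ ?_)
    rintro ⟨i, j', a, b, c', d', hxv, hyv⟩
    obtain ⟨-, hc, hd⟩ := d2r_index_inj c.isLt d.isLt c'.isLt d'.isLt hyv
    obtain rfl := Fin.ext hc
    obtain rfl := Fin.ext hd
    exact hx ⟨((i, a), b), Fin.ext hxv.symm⟩
  · rintro ⟨⟨i, a⟩, b⟩
    have hD := hDr i ⟨a.val + c.val, row_lt _ _⟩ ⟨b.val + d.val, row_lt _ _⟩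
    simp only [hC, hD, mul_comm (K i j a b), add_comm c.val, add_comm d.val]
end
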